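/- arXiv:1312.0915 — 2 statements merged into one kernel-verified Lean document; each statement's English description precedes it below -/
import Mathlib

section
/- Let π(y) = h(‖y‖) for a nonincreasing function h : [0,∞) → (0,∞) (a spherically symmetric, radially nonincreasing density), and let g be a probability density on (0,∞) with G(S) = ∫_S g(ε)dε. Then lim_{‖x‖→∞} G({ε > 0 : ∃ b ∈ {−1,1}^d with π(x + εb) ≥ π(x)}) = 1; in particular the additive TMCMC overall acceptance region A^{(1)}(x) = {ε > 0 : ∃ b ∈ {−1,1}^d, π(x+εb) ≥ π(x)} satisfies liminf_{‖x‖→∞} G(A^{(1)}(x)) > 0. -/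
open MeasureTheory Filter Set

/-- The additive TMCMC move-type vector: a vector in `{−1,1}^d` encoded by `b : Fin d → Bool`. -/
noncomputable def signVec {d : ℕ} (b : Fin d → Bool) : EuclideanSpace ℝ (Fin d) :=
  (EuclideanSpace.equiv (Fin d) ℝ).symm (fun i => if b i then 1 else -1)

/-- for a spherically symmetric, radially nonincreasing density, the proposal
mass of the overall additive TMCMC acceptance region tends to 1 as `‖x‖ → ∞`; in particular
its liminf is positive. -/
theorem stmt8 {d : ℕ} (hd : 1 ≤ d)
    (h : ℝ → ℝ) (hpos : ∀ r : ℝ, 0 ≤ r → 0 < h r) (hanti : AntitoneOn h (Set.Ici 0))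
    (π : EuclideanSpace ℝ (Fin d) → ℝ) (hπ : ∀ y, π y = h ‖y‖)
    (g : ℝ → ℝ) (hg0 : ∀ ε, 0 ≤ g ε) (hgsupp : ∀ ε ≤ (0:ℝ), g ε = 0)
    (hgmeas : Measurable g) (hgint : ∫ ε, g ε = 1)
    (G : Set ℝ → ℝ) (hG : ∀ S, G S = ∫ ε in S, g ε)
    (A : EuclideanSpace ℝ (Fin d) → Set ℝ)
    (hA : ∀ x, A x = {ε : ℝ | 0 < ε ∧ ∃ b : Fin d → Bool, π x ≤ π (x + ε • signVec b)}) :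
    Tendsto (fun x => G (A x))
      (comap (fun x : EuclideanSpace ℝ (Fin d) => ‖x‖) atTop) (nhds 1)
    ∧ 0 < liminf (fun x => G (A x))
        (comap (fun x : EuclideanSpace ℝ (Fin d) => ‖x‖) atTop) := by
  have hgI : Integrable g := by
    by_contra hn
    rw [integral_undef hn] at hgint
    exact zero_ne_one hgint
  have hdpos : (0:ℝ) < d := by exact_mod_cast hd
  have hT : Tendsto (fun x : EuclideanSpace ℝ (Fin d) => 2 * ‖x‖ / d)
      (comap (fun x : EuclideanSpace ℝ (Fin d) => ‖x‖) atTop) atTop :=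
    (tendsto_comap.const_mul_atTop two_pos).atTop_div_const hdpos
  have hcov : Tendsto (fun a : ℝ => ∫ ε in Iic a, g ε) atTop (nhds 1) := by
    rw [← hgint]
    exact (aecover_Iic tendsto_id).integral_tendsto_of_countably_generated hgI
  have key : ∀ x : EuclideanSpace ℝ (Fin d), Ioc 0 (2 * ‖x‖ / d) ⊆ A x := by
    intro x ε hε
    obtain ⟨h0, h1⟩ := hε
    rw [hA]
    refine ⟨h0, fun i => decide (x i < 0), ?_⟩
    rw [hπ, hπ]
    apply hanti (norm_nonneg _) (norm_nonneg _)
    rw [le_div_iff₀ hdpos] at h1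
    have hc : ∀ i, (x + ε • signVec (fun i => decide (x i < 0))) i ^ 2
        = x i ^ 2 - 2 * ε * |x i| + ε ^ 2 := by
      intro i
      by_cases hx : x i < 0
      · simp [signVec, hx, abs_of_neg hx]; ring
      · simp [signVec, hx, abs_of_nonneg (not_lt.1 hx)]; ring
    have hsq : ‖x‖ ^ 2 ≤ (∑ i, |x i|) ^ 2 := by
      rw [EuclideanSpace.real_norm_sq_eq]
      simp_rw [← sq_abs (x _)]
      exact Finset.sum_sq_le_sq_sum_of_nonneg (fun i _ => abs_nonneg _)
    have hsum : ‖x‖ ≤ ∑ i, |x i| :=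
      (sq_le_sq₀ (norm_nonneg _) (Finset.sum_nonneg fun i _ => abs_nonneg _)).1 hsq
    refine (sq_le_sq₀ (norm_nonneg _) (norm_nonneg _)).1 ?_
    rw [EuclideanSpace.real_norm_sq_eq, EuclideanSpace.real_norm_sq_eq]
    simp_rw [hc]
    rw [Finset.sum_add_distrib, Finset.sum_sub_distrib, ← Finset.mul_sum]
    simp only [Finset.sum_const, Finset.card_univ, Fintype.card_fin, nsmul_eq_mul]
    nlinarith
  have hlow : ∀ x, ∫ ε in Iic (2 * ‖x‖ / d), g ε ≤ G (A x) := by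
    intro x
    rw [hG, setIntegral_eq_of_subset_of_forall_diff_eq_zero measurableSet_Iic
      (Ioc_subset_Iic_self (a := 0))]
    · exact setIntegral_mono_set hgI.integrableOn (Eventually.of_forall hg0)
        (key x).eventuallyLE
    · intro ε hε
      apply hgsupp
      by_contra hn
      exact hε.2 ⟨not_le.1 hn, hε.1⟩
  have hup : ∀ x, G (A x) ≤ 1 := by
    intro x
    rw [hG, ← hgint]
    exact setIntegral_le_integral hgI (Eventually.of_forall hg0)
  have hmain : Tendsto (fun x => G (A x))
      (comap (fun x : EuclideanSpace ℝ (Fin d) => ‖x‖) atTop) (nhds 1) :=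
    tendsto_of_tendsto_of_tendsto_of_le_of_le (hcov.comp hT) tendsto_const_nhds hlow hup
  refine ⟨hmain, ?_⟩
  haveI : Nonempty (Fin d) := ⟨⟨0, hd⟩⟩
  haveI : (comap (fun x : EuclideanSpace ℝ (Fin d) => ‖x‖) atTop).NeBot := by
    have := NormedSpace.cobounded_neBot ℝ (EuclideanSpace ℝ (Fin d))
    rwa [← comap_norm_atTop] at this
  rw [hmain.liminf_eq]
  exact one_pos
end

section
/- Let π : ℝ² → (0,∞) be measurable and let g be a probability density on [−1,1]. Let (x_n) be a sequence of positive reals decreasing to 0. Then: (i) for every fixed v₂ ∈ ℝ and every y > 0, the multiplicative TMCMC kernel satisfies P((x_n, v₂), {z ∈ ℝ² : |z₁| ≥ y}) → 0 as n → ∞; and (ii) for the sequence v_n = (x_n, x_n) and every y > 0, P(v_n, {z ∈ ℝ² : max(|z₁|, |z₂|) ≥ y}) → 0 as n → ∞. Consequently, points with a zero coordinate cannot be limit points of small sets of the multiplicative TMCMC chain. -/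
open MeasureTheory Filter

/-- The two-dimensional multiplicative TMCMC transformation `T_b(x,ε)`, with move-type
`b ∈ {−1,0,1}²` encoded by `m : Fin 2 → Fin 3` via the exponent `b i = (m i : ℤ) − 1`. -/
noncomputable def multT2 (x : ℝ × ℝ) (m : Fin 2 → Fin 3) (ε : ℝ) : ℝ × ℝ :=
  (x.1 * ε ^ (((m 0 : ℕ) : ℤ) - 1), x.2 * ε ^ (((m 1 : ℕ) : ℤ) - 1))

/-- The Jacobian factor `|J(b,ε)| = |ε|^{b₁+b₂}`. -/
noncomputable def multJ2 (m : Fin 2 → Fin 3) (ε : ℝ) : ℝ :=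
  |ε| ^ ((((m 0 : ℕ) : ℤ) - 1) + (((m 1 : ℕ) : ℤ) - 1))

/-- The multiplicative TMCMC acceptance probability `α_b(x,ε)` in dimension 2. -/
noncomputable def alpha2 (π : ℝ × ℝ → ℝ) (x : ℝ × ℝ) (m : Fin 2 → Fin 3) (ε : ℝ) : ℝ :=
  min 1 ((π (multT2 x m ε) / π x) * multJ2 m ε)

theorem tmcmc_aux
    (π : ℝ × ℝ → ℝ) (hπpos : ∀ x, 0 < π x) (hπmeas : Measurable π)
    (g : ℝ → ℝ) (hg0 : ∀ ε, 0 ≤ g ε) (hgmeas : Measurable g)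
    (hgi : Integrable g)
    (P : ℝ × ℝ → Set (ℝ × ℝ) → ℝ)
    (hP : ∀ x A, P x A = (1/9 : ℝ) * ∑ m : Fin 2 → Fin 3, ∫ ε in Set.Icc (-1:ℝ) 1,
        (Set.indicator A (fun _ => (1:ℝ)) (multT2 x m ε) * alpha2 π x m ε
          + Set.indicator A (fun _ => (1:ℝ)) x * (1 - alpha2 π x m ε)) * g ε)
    (v : ℕ → ℝ × ℝ) (A : Set (ℝ × ℝ)) (hA : MeasurableSet A)
    (h1 : ∀ᶠ n in atTop, v n ∉ A)
    (h2 : ∀ m ε, ∀ᶠ n in atTop, multT2 (v n) m ε ∉ A) :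
    Tendsto (fun n => P (v n) A) atTop (nhds 0) := by
  have hT : ∀ x m, Measurable (multT2 x m) := by
    intro x m
    have hz : ∀ k : ℤ, Measurable (fun ε : ℝ => ε ^ k) := by
      intro k
      exact measurable_id.pow_const k
    exact ((hz _).const_mul _).prodMk ((hz _).const_mul _)
  have hJ : ∀ m, Measurable (multJ2 m) := by
    intro m
    exact (continuous_abs.measurable).pow_const _
  have hal : ∀ x m, Measurable (alpha2 π x m) := by
    intro x m
    exact measurable_const.min (((hπmeas.comp (hT x m)).div_const _).mul (hJ m))
  have ha0 : ∀ x m ε, 0 ≤ alpha2 π x m ε := by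
    intro x m ε
    refine le_min zero_le_one (mul_nonneg (div_nonneg (hπpos _).le (hπpos _).le) ?_)
    exact zpow_nonneg (abs_nonneg _) _
  have ha1 : ∀ x m ε, alpha2 π x m ε ≤ 1 := fun x m ε => min_le_left _ _
  have key : ∀ m : Fin 2 → Fin 3, Tendsto (fun n => ∫ ε in Set.Icc (-1:ℝ) 1,
        (Set.indicator A (fun _ => (1:ℝ)) (multT2 (v n) m ε) * alpha2 π (v n) m ε
          + Set.indicator A (fun _ => (1:ℝ)) (v n) * (1 - alpha2 π (v n) m ε)) * g ε)
        atTop (nhds (∫ ε in Set.Icc (-1:ℝ) 1, (0:ℝ))) := by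
    intro m
    refine tendsto_integral_of_dominated_convergence g ?_ hgi.integrableOn ?_ ?_
    · intro n
      have hi : Measurable (fun ε => Set.indicator A (fun _ => (1:ℝ)) (multT2 (v n) m ε)) :=
        (measurable_const.indicator hA).comp (hT _ _)
      exact (((hi.mul (hal _ _)).add ((measurable_const.sub (hal _ _)).const_mul _)).mul
        hgmeas).aestronglyMeasurable
    · intro n
      refine Eventually.of_forall fun ε => ?_
      have a0 := ha0 (v n) m ε
      have a1 := ha1 (v n) m ε
      rw [Real.norm_eq_abs, abs_mul, abs_of_nonneg (hg0 ε)]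
      refine mul_le_of_le_one_left (hg0 ε) ?_
      rw [abs_le]
      by_cases c1 : multT2 (v n) m ε ∈ A <;> by_cases c2 : v n ∈ A <;>
        simp only [Set.indicator, c1, c2, if_true, if_false] <;> constructor <;> linarith
    · refine Eventually.of_forall fun ε => ?_
      refine tendsto_const_nhds.congr' ?_
      filter_upwards [h1, h2 m ε] with n c2 c1
      simp [Set.indicator, c1, c2]
  simp only [hP]
  have := (tendsto_finsetSum Finset.univ (fun m _ => key m)).const_mul (1/9 : ℝ)
  simpa using this

/-- for the 2-dimensional multiplicative TMCMC kernel, starting from points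
approaching the coordinate axes, the probability of reaching a region bounded away from the
axes tends to 0. -/
theorem stmt18
    (π : ℝ × ℝ → ℝ) (hπpos : ∀ x, 0 < π x) (hπmeas : Measurable π)
    (g : ℝ → ℝ) (hg0 : ∀ ε, 0 ≤ g ε) (hgmeas : Measurable g)
    (hgsupp : ∀ ε : ℝ, g ε ≠ 0 → ε ∈ Set.Icc (-1:ℝ) 1)
    (hgint : ∫ ε, g ε = 1)
    (P : ℝ × ℝ → Set (ℝ × ℝ) → ℝ)
    (hP : ∀ x A, P x A = (1/9 : ℝ) * ∑ m : Fin 2 → Fin 3, ∫ ε in Set.Icc (-1:ℝ) 1,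
        (Set.indicator A (fun _ => (1:ℝ)) (multT2 x m ε) * alpha2 π x m ε
          + Set.indicator A (fun _ => (1:ℝ)) x * (1 - alpha2 π x m ε)) * g ε)
    (x : ℕ → ℝ) (hxpos : ∀ n, 0 < x n) (hxanti : Antitone x)
    (hx0 : Tendsto x atTop (nhds 0)) :
    (∀ v₂ : ℝ, ∀ y : ℝ, 0 < y →
      Tendsto (fun n => P (x n, v₂) {z : ℝ × ℝ | y ≤ |z.1|}) atTop (nhds 0))
    ∧ (∀ y : ℝ, 0 < y →
      Tendsto (fun n => P (x n, x n) {z : ℝ × ℝ | y ≤ max |z.1| |z.2|})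
        atTop (nhds 0)) := by
  have hgi : Integrable g := by
    by_contra h
    rw [integral_undef h] at hgint
    exact zero_ne_one hgint
  have hc : ∀ c y : ℝ, 0 < y → ∀ᶠ n in atTop, |x n * c| < y := by
    intro c y hy
    have h := (hx0.mul_const c).abs
    rw [zero_mul, abs_zero] at h
    exact h.eventually_lt_const hy
  constructor
  · intro v₂ y hy
    refine tmcmc_aux π hπpos hπmeas g hg0 hgmeas hgi P hP (fun n => (x n, v₂)) _ ?_ ?_ ?_
    · exact measurableSet_le measurable_const (continuous_fst.abs.measurable)
    · filter_upwards [hc 1 y hy] with n hn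
      simpa using hn
    · intro m ε
      filter_upwards [hc _ y hy] with n hn
      exact not_le.mpr hn
  · intro y hy
    refine tmcmc_aux π hπpos hπmeas g hg0 hgmeas hgi P hP (fun n => (x n, x n)) _ ?_ ?_ ?_
    · exact measurableSet_le measurable_const
        ((continuous_fst.abs.max continuous_snd.abs).measurable)
    · filter_upwards [hc 1 y hy] with n hn
      simpa using hn
    · intro m ε
      filter_upwards [hc _ y hy, hc _ y hy] with n hn hn2
      exact not_le.mpr (max_lt hn hn2)
end
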